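/- Let r ≥ 1 and m ≥ 1 be integers, set g = (r+1)m and d = g + r − m, so that ρ = g − (r+1)(g−d+r) = 0. Let p_0, p_1, …, p_g be an admissible lingering lattice path in ℤ^r with p_0 = (r, r−1, …, 1), lying entirely in the open Weyl chamber C, with exactly m steps equal to (−1,−1,…,−1). Then the path has no lingering steps, it has exactly m steps in each coordinate direction e_j (0 ≤ j ≤ r−1), and p_g = (r, r−1, …, 1). -/

import Mathlib

open scoped Classical

/-- The `i`-th step of the path `p` is the vector `(−1, …, −1)`. -/
def negStep (r : ℕ) (p : ℕ → Fin r → ℤ) (i : ℕ) : Prop :=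
  ∀ k, p i k = p (i - 1) k - 1

/-- The `i`-th step of the path `p` is the standard basis vector `e j`. -/
def eStep (r : ℕ) (p : ℕ → Fin r → ℤ) (i : ℕ) (j : Fin r) : Prop :=
  ∀ k, p i k = p (i - 1) k + if k = j then 1 else 0

/-- The `i`-th step of the path `p` is zero (a lingering step). -/
def lingerStep (r : ℕ) (p : ℕ → Fin r → ℤ) (i : ℕ) : Prop :=
  ∀ k, p i k = p (i - 1) k

/-- `p 0, p 1, …, p g` is a lingering lattice path in `ℤ^r`: each successive difference is
`(−1, …, −1)`, a standard basis vector, or zero. -/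
def IsLLP (r g : ℕ) (p : ℕ → Fin r → ℤ) : Prop :=
  ∀ i ∈ Finset.Icc 1 g, negStep r p i ∨ (∃ j, eStep r p i j) ∨ lingerStep r p i

/-- The open Weyl chamber `C = {y : y 0 > y 1 > ⋯ > y (r−1) > 0}`. -/
def inC (r : ℕ) (y : Fin r → ℤ) : Prop :=
  (∀ j k : Fin r, j < k → y k < y j) ∧ ∀ k, 0 < y k

/-- The path is admissible: every step in a coordinate direction `e j` occurs only when
both `p (i−1)` and `p (i−1) + e j` lie in the open Weyl chamber. -/
def Admissible (r g : ℕ) (p : ℕ → Fin r → ℤ) : Prop :=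
  ∀ i ∈ Finset.Icc 1 g, ∀ j, eStep r p i j → inC r (p (i - 1)) ∧ inC r (p i)

/-- In the open Weyl chamber the `k`-th coordinate is at least `r - k`. -/
lemma inC.sub_le {r : ℕ} {y : Fin r → ℤ} (h : inC r y) (k : Fin r) :
    (r : ℤ) - (k : ℤ) ≤ y k := by
  suffices H : ∀ (n : ℕ) (k : Fin r), (k : ℕ) + n + 1 = r → (n : ℤ) + 1 ≤ y k by
    have := H (r - 1 - k) k (by omega)
    omega
  intro n
  induction n with
  | zero =>
    intro k _
    have := h.2 k
    push_cast
    omega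
  | succ n ih =>
    intro k hk
    have hnext := ih ⟨k + 1, by omega⟩ (by simp only; omega)
    have hlt := h.1 k ⟨k + 1, by omega⟩ (by simp [Fin.lt_def])
    push_cast
    omega

/-- Each step changes the `j`-th coordinate according to whether it is `e j` or
`(−1, …, −1)`. -/
lemma IsLLP.sub_eq {r g : ℕ} {p : ℕ → Fin r → ℤ} (h : IsLLP r g p) {i : ℕ}
    (hi : i ∈ Finset.Icc 1 g) (j : Fin r) :
    p i j - p (i - 1) j =
      (if eStep r p i j then 1 else 0) - (if negStep r p i then 1 else 0) := by
  have he : eStep r p i j → p i j = p (i - 1) j + 1 := fun h => by simpa using h j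
  have hn : negStep r p i → p i j = p (i - 1) j - 1 := fun h => h j
  by_cases h1 : eStep r p i j <;> by_cases h2 : negStep r p i
  · have := he h1
    have := hn h2
    omega
  · simp [h1, h2, he h1]
  · simp [h1, h2, hn h2]
  · rcases h i hi with h3 | ⟨k, hk⟩ | h3
    · exact absurd h3 h2
    · have hjk : j ≠ k := by
        rintro rfl
        exact h1 hk
      simp [h1, h2, hk j, hjk]
    · simp [h1, h2, h3 j]

/-- The endpoint of the path, in terms of the number of steps of each kind. -/
lemma IsLLP.apply_eq {r g : ℕ} {p : ℕ → Fin r → ℤ} (h : IsLLP r g p) (j : Fin r) :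
    p g j = p 0 j + (((Finset.Icc 1 g).filter (fun i => eStep r p i j)).card : ℤ) -
      (((Finset.Icc 1 g).filter (fun i => negStep r p i)).card : ℤ) := by
  have hsum : ∑ i ∈ Finset.Icc 1 g, (p i j - p (i - 1) j) = p g j - p 0 j := by
    rw [← Finset.sum_range_sub (fun i => p i j) g, Finset.range_eq_Ico]
    exact (Finset.sum_Ico_add' (fun i => p i j - p (i - 1) j) 0 g 1).symm
  rw [Finset.sum_congr rfl fun i hi => h.sub_eq hi j, Finset.sum_sub_distrib] at hsum
  simp only [Finset.sum_boole] at hsum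
  linarith

/-- A step is of at most one kind. -/
lemma step_kinds_le_one {r : ℕ} (hr : 1 ≤ r) (p : ℕ → Fin r → ℤ) (i : ℕ) :
    (if negStep r p i then 1 else 0) + ∑ j, (if eStep r p i j then 1 else 0) +
      (if lingerStep r p i then 1 else 0) ≤ 1 := by
  by_cases he : ∃ j, eStep r p i j
  · obtain ⟨j, hj⟩ := he
    have hjj : p i j = p (i - 1) j + 1 := by simpa using hj j
    have hn : ¬ negStep r p i := fun h => by have := h j; omega
    have hl : ¬ lingerStep r p i := fun h => by have := h j; omega
    have huniq : ∀ k, eStep r p i k ↔ k = j := by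
      refine fun k => ⟨fun hk => ?_, fun hk => hk ▸ hj⟩
      by_contra hne
      have := hk j
      rw [if_neg (Ne.symm hne)] at this
      omega
    simp [hn, hl, huniq]
  · have hzero : ∀ j, ¬ eStep r p i j := not_exists.mp he
    have hnl : ¬ (negStep r p i ∧ lingerStep r p i) := fun ⟨hn, hl⟩ => by
      have := hn ⟨0, hr⟩
      have := hl ⟨0, hr⟩
      omega
    by_cases hn : negStep r p i <;> by_cases hl : lingerStep r p i <;> simp_all

/-- The numbers of steps of the various kinds add up to at most the length of the path. -/
lemma card_steps_le {r : ℕ} (hr : 1 ≤ r) (g : ℕ) (p : ℕ → Fin r → ℤ) :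
    ((Finset.Icc 1 g).filter (fun i => negStep r p i)).card +
      ∑ j, ((Finset.Icc 1 g).filter (fun i => eStep r p i j)).card +
      ((Finset.Icc 1 g).filter (fun i => lingerStep r p i)).card ≤ g := by
  have h := Finset.sum_le_sum fun i (_ : i ∈ Finset.Icc 1 g) => step_kinds_le_one hr p i
  rw [Finset.sum_add_distrib, Finset.sum_add_distrib, Finset.sum_comm] at h
  simp only [Finset.card_filter]
  simpa only [Finset.sum_const, Nat.card_Icc, smul_eq_mul, mul_one, Nat.add_sub_cancel] using h

/-- Let `r ≥ 1`, `m ≥ 1`, `g = (r+1)m` and `d = g + r − m` (so `ρ = 0`).  Every admissible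
lingering lattice path in `ℤ^r` starting at `(r, r−1, …, 1)`, lying entirely in the open Weyl
chamber, with exactly `m` steps equal to `(−1, …, −1)`, has no lingering steps, has exactly
`m` steps in each coordinate direction, and ends at `p g = (r, r−1, …, 1)`. -/
theorem rho_zero_path_structure
    (r m : ℕ) (hr : 1 ≤ r) (hm : 1 ≤ m) (g d : ℕ)
    (hg : g = (r + 1) * m) (hd : d = g + r - m)
    (p : ℕ → Fin r → ℤ) (hpath : IsLLP r g p) (hadm : Admissible r g p)
    (hstart : ∀ j : Fin r, p 0 j = (r : ℤ) - (j : ℤ))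
    (hC : ∀ i ≤ g, inC r (p i))
    (hneg : ((Finset.Icc 1 g).filter (fun i => negStep r p i)).card = m) :
    (∀ i ∈ Finset.Icc 1 g, ¬ lingerStep r p i) ∧
    (∀ j : Fin r, ((Finset.Icc 1 g).filter (fun i => eStep r p i j)).card = m) ∧
    (∀ j : Fin r, p g j = (r : ℤ) - (j : ℤ)) := by
  have hpos := hpath.apply_eq
  have hge : ∀ j ∈ Finset.univ,
      m ≤ ((Finset.Icc 1 g).filter (fun i => eStep r p i j)).card := fun j _ => by
    have := (hC g le_rfl).sub_le j
    have := hpos j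
    have := hstart j
    omega
  have htot := card_steps_le hr g p
  have hsum := Finset.sum_le_sum hge
  have hconst : ∑ _j : Fin r, m = r * m := by simp
  have hg' : g = r * m + m := by rw [hg]; ring
  have heq : ∀ j, ((Finset.Icc 1 g).filter (fun i => eStep r p i j)).card = m := fun j =>
    ((Finset.sum_eq_sum_iff_of_le hge).mp (by omega) j (Finset.mem_univ j)).symm
  refine ⟨fun i hi hl => ?_, heq, fun j => ?_⟩
  · have : 0 < ((Finset.Icc 1 g).filter (fun i => lingerStep r p i)).card :=
      Finset.card_pos.mpr ⟨i, Finset.mem_filter.mpr ⟨hi, hl⟩⟩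
    omega
  · rw [hpos j, heq j, hneg, hstart j]
    ring
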